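/- Let λ ∈ P_n. The ideal Sss({λ}) is a transversal polymatroidal ideal if and only if there exist non-negative integers a_1,...,a_n such that λ_i = Σ_{j=1}^i binom(i−1, j−1) a_j for every 1 ≤ i ≤ n. -/

import Mathlib

open MvPolynomial

/-- The monomial `x^a` in `K[x_1,...,x_n]`. -/
noncomputable def mon (K : Type) [Field K] (n : ℕ) (a : Fin n → ℕ) :
    MvPolynomial (Fin n) K :=
  monomial (Finsupp.equivFunOnFinite.symm a) 1

/-- A monomial ideal: an ideal generated by monomials. -/
def IsMonomialIdeal (K : Type) [Field K] (n : ℕ)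
    (I : Ideal (MvPolynomial (Fin n) K)) : Prop :=
  ∃ S : Set (Fin n → ℕ), I = Ideal.span (mon K n '' S)

/-- A symmetric (`𝔖_n`-fixed) ideal. -/
def IsSymmetricIdeal (K : Type) [Field K] (n : ℕ)
    (I : Ideal (MvPolynomial (Fin n) K)) : Prop :=
  ∀ σ : Equiv.Perm (Fin n), Ideal.map (rename (σ : Fin n → Fin n)) I = I

/-- The exponent vector obtained from `a` by the Borel move `x^a ↦ x^a · x_i / x_j`. -/
def borelMoveVec (n : ℕ) (a : Fin n → ℕ) (i j : Fin n) : Fin n → ℕ :=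
  fun k => if k = i then a k + 1 else if k = j then a k - 1 else a k

/-- A symmetric strongly shifted ideal (sssi). -/
def IsSSSI (K : Type) [Field K] (n : ℕ)
    (I : Ideal (MvPolynomial (Fin n) K)) : Prop :=
  IsMonomialIdeal K n I ∧ IsSymmetricIdeal K n I ∧
    ∀ lam : Fin n → ℕ, Monotone lam → mon K n lam ∈ I →
      ∀ i j : Fin n, i < j → lam i < lam j →
        mon K n (borelMoveVec n lam i j) ∈ I

/-- The dominance order on partitions: `μ ⊴ λ`. -/
def dominates (n : ℕ) (μ lam : Fin n → ℕ) : Prop :=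
  ∀ k : Fin n, ∑ i ∈ Finset.Ici k, μ i ≤ ∑ i ∈ Finset.Ici k, lam i

/-- `Sss(B)`: the smallest symmetric strongly shifted ideal containing the
monomials `x^λ`, `λ ∈ B`. -/
noncomputable def Sss (K : Type) [Field K] (n : ℕ) (B : Set (Fin n → ℕ)) :
    Ideal (MvPolynomial (Fin n) K) :=
  sInf {J | IsSSSI K n J ∧ ∀ lam ∈ B, mon K n lam ∈ J}

/-- A transversal polymatroidal ideal: a product of monomial prime ideals
(ideals generated by subsets of the variables), repeated factors allowed. -/
def IsTransversalPolymatroidal (K : Type) [Field K] (n : ℕ)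
    (I : Ideal (MvPolynomial (Fin n) K)) : Prop :=
  ∃ (s : ℕ) (f : Fin s → Finset (Fin n)),
    I = ∏ k : Fin s,
      Ideal.span ((fun i => (X i : MvPolynomial (Fin n) K)) '' ↑(f k))

/-- The sum of the entries of `lam` at the first `m` indices. -/
def prefixSum {n : ℕ} (lam : Fin n → ℕ) (m : ℕ) : ℕ :=
  ∑ i ∈ Finset.univ.filter fun i : Fin n => (i : ℕ) < m, lam i

/-- The monomial ideal spanned by the `x^v` whose partial sums over subsets are bounded
below by `g`. -/
noncomputable def boundedBelowIdeal (K : Type) [Field K] (n : ℕ) (g : Finset (Fin n) → ℕ) :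
    Ideal (MvPolynomial (Fin n) K) :=
  Ideal.span (mon K n '' {v | ∀ T : Finset (Fin n), g T ≤ ∑ i ∈ T, v i})

section Monomials

variable {K : Type} [Field K] {n : ℕ}

lemma mon_mem_span_iff (S : Set (Fin n → ℕ)) (v : Fin n → ℕ) :
    mon K n v ∈ Ideal.span (mon K n '' S) ↔ ∃ u ∈ S, ∀ i, u i ≤ v i := by
  have h : mon K n '' S =
      (fun s => monomial s (1 : K)) '' (Finsupp.equivFunOnFinite.symm '' S) := by
    rw [Set.image_image]; rfl
  rw [h, mem_ideal_span_monomial_image]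
  classical
  simp only [mon, support_monomial, one_ne_zero, if_false, Finset.mem_singleton, forall_eq,
    Set.exists_mem_image, Finsupp.le_def]
  rfl

lemma mon_mem_of_le {I : Ideal (MvPolynomial (Fin n) K)} {u v : Fin n → ℕ}
    (hu : mon K n u ∈ I) (h : ∀ i, u i ≤ v i) : mon K n v ∈ I := by
  have h1 : mon K n v ∈ Ideal.span (mon K n '' {u}) :=
    (mon_mem_span_iff _ _).2 ⟨u, rfl, h⟩
  refine (Ideal.span_le.2 ?_) h1
  simpa using hu

lemma mon_mem_boundedBelowIdeal (g : Finset (Fin n) → ℕ) (v : Fin n → ℕ) :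
    mon K n v ∈ boundedBelowIdeal K n g ↔ ∀ T : Finset (Fin n), g T ≤ ∑ i ∈ T, v i := by
  rw [boundedBelowIdeal, mon_mem_span_iff]
  constructor
  · rintro ⟨u, hu, h⟩ T
    exact (hu T).trans (Finset.sum_le_sum fun i _ => h i)
  · intro h
    exact ⟨v, h, fun _ => le_rfl⟩

lemma rename_mon (σ : Equiv.Perm (Fin n)) (v : Fin n → ℕ) :
    rename σ (mon K n v) = mon K n (v ∘ σ.symm) := by
  rw [mon, mon, rename_monomial]
  refine congrArg (fun s => monomial s (1 : K)) (Finsupp.ext fun i => ?_)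
  rw [Finsupp.mapDomain_equiv_apply]
  simp

lemma mon_comp_mem {I : Ideal (MvPolynomial (Fin n) K)} (hI : IsSymmetricIdeal K n I)
    {v : Fin n → ℕ} (hv : mon K n v ∈ I) (σ : Equiv.Perm (Fin n)) :
    mon K n (v ∘ σ) ∈ I := by
  have := Ideal.mem_map_of_mem (rename (σ.symm : Fin n → Fin n)) hv
  rwa [hI σ.symm, rename_mon] at this

end Monomials

section BorelMoves

variable {K : Type} [Field K] {n : ℕ}

lemma sum_borelMoveVec (u : Fin n → ℕ) {i j : Fin n} (hij : i ≠ j) (hj : 0 < u j)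
    (T : Finset (Fin n)) :
    (∑ k ∈ T, borelMoveVec n u i j k) + (if j ∈ T then 1 else 0) =
      (∑ k ∈ T, u k) + (if i ∈ T then 1 else 0) := by
  have h : ∀ k, borelMoveVec n u i j k + (if k = j then 1 else 0) =
      u k + (if k = i then 1 else 0) := by
    intro k
    unfold borelMoveVec
    grind
  have := Finset.sum_congr (rfl : T = T) fun k _ => h k
  simpa [Finset.sum_add_distrib] using this

lemma isSSSI_boundedBelowIdeal (G : ℕ → ℕ) :
    IsSSSI K n (boundedBelowIdeal K n fun T => G T.card) := by
  refine ⟨⟨_, rfl⟩, ?_, ?_⟩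
  · have key : ∀ σ : Equiv.Perm (Fin n),
        Ideal.map (rename (σ : Fin n → Fin n)) (boundedBelowIdeal K n fun T => G T.card) ≤
          boundedBelowIdeal K n fun T => G T.card := by
      intro σ
      rw [Ideal.map_le_iff_le_comap]
      conv_lhs => rw [boundedBelowIdeal]
      rw [Ideal.span_le]
      rintro _ ⟨v, hv, rfl⟩
      rw [SetLike.mem_coe, Ideal.mem_comap]
      rw [rename_mon, mon_mem_boundedBelowIdeal]
      intro T
      have := hv (T.map σ.symm.toEmbedding)
      simpa using this
    intro σ
    refine le_antisymm (key σ) ?_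
    have h := Ideal.map_mono (f := rename (R := K) (σ : Fin n → Fin n)) (key σ.symm)
    refine le_trans (fun x hx => ?_) h
    have h2 := Ideal.mem_map_of_mem (rename (R := K) (σ : Fin n → Fin n))
      (Ideal.mem_map_of_mem (rename (R := K) (σ.symm : Fin n → Fin n)) hx)
    rw [rename_rename] at h2
    simpa using h2
  · intro v _ hv i j hij hlt
    rw [mon_mem_boundedBelowIdeal] at hv ⊢
    intro T
    have hs := sum_borelMoveVec v hij.ne (by omega) T
    have hT := hv T
    by_cases hj : j ∈ T
    · by_cases hi : i ∈ T
      · simp [hi, hj] at hs; omega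
      · have h2 := hv (insert i (T.erase j))
        have hi' : i ∉ T.erase j := fun h => hi (Finset.mem_of_mem_erase h)
        have h3 := Finset.add_sum_erase T v hj
        have h4 := Finset.card_erase_add_one hj
        rw [Finset.sum_insert hi', Finset.card_insert_of_notMem hi', h4] at h2
        simp [hi, hj] at hs
        omega
    · simp [hj] at hs
      omega

lemma mon_mem_of_prefix_le {I : Ideal (MvPolynomial (Fin n) K)} (hI : IsSSSI K n I)
    {v : Fin n → ℕ} (hv : Monotone v) (u : Fin n → ℕ) (hu : Monotone u)
    (huI : mon K n u ∈ I) (h : ∀ j, ∑ i ∈ Finset.Iic j, u i ≤ ∑ i ∈ Finset.Iic j, v i) :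
    mon K n v ∈ I := by
  by_cases hle : ∀ i, u i ≤ v i
  · exact mon_mem_of_le huI hle
  obtain ⟨j, hj, hjmin⟩ : ∃ j, v j < u j ∧ ∀ k < j, u k ≤ v k := by
    have hne : (Finset.univ.filter fun k => v k < u k).Nonempty := by
      push Not at hle
      obtain ⟨i, hi⟩ := hle
      exact ⟨i, by simpa using hi⟩
    refine ⟨_, (Finset.mem_filter.1 (Finset.min'_mem _ hne)).2, fun k hk => ?_⟩
    by_contra hc
    exact absurd hk (not_lt.2 (Finset.min'_le _ k (by simpa using hc)))
  obtain ⟨i, hij, hi, himax⟩ : ∃ i, i < j ∧ u i < v i ∧ ∀ k, i < k → k < j → v k ≤ u k := by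
    have hne : (Finset.univ.filter fun k => k < j ∧ u k < v k).Nonempty := by
      by_contra hc
      rw [Finset.not_nonempty_iff_eq_empty, Finset.filter_eq_empty_iff] at hc
      have : ∑ i ∈ Finset.Iic j, v i < ∑ i ∈ Finset.Iic j, u i := by
        refine Finset.sum_lt_sum (fun k hk => ?_) ⟨j, by simp, hj⟩
        rcases (Finset.mem_Iic.1 hk).lt_or_eq with hk | rfl
        · have := hc (Finset.mem_univ k)
          simp only [hk, true_and, not_lt] at this
          exact this
        · exact hj.le
      exact absurd (h j) (not_le.2 this)
    have hm := (Finset.mem_filter.1 (Finset.max'_mem _ hne)).2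
    refine ⟨_, hm.1, hm.2, fun k hk hkj => ?_⟩
    by_contra hc
    exact absurd hk (not_lt.2 (Finset.le_max' _ k (by simpa [hkj] using hc)))
  have hvij := hv hij.le
  have hmon : Monotone (borelMoveVec n u i j) := by
    intro a b hab
    have h1 := hu hab
    have h2 := hv hab
    have h3 := himax b
    have h4 := himax a
    have h5 := hjmin a
    have h6 : j ≤ b → u j ≤ u b := fun hb => hu hb
    unfold borelMoveVec
    grind
  have hdec : ∑ k, (borelMoveVec n u i j k - v k) < ∑ k, (u k - v k) := by
    refine Finset.sum_lt_sum (fun k _ => ?_) ⟨j, Finset.mem_univ j, ?_⟩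
    · unfold borelMoveVec
      grind
    · unfold borelMoveVec
      grind
  refine mon_mem_of_prefix_le hI hv (borelMoveVec n u i j) hmon
    (hI.2.2 u hu huI i j hij (by omega)) fun m => ?_
  by_cases hm : j ≤ m
  · have hs := sum_borelMoveVec u hij.ne (by omega) (Finset.Iic m)
    have hi' : i ≤ m := hij.le.trans hm
    simp [hm, hi'] at hs
    rw [hs]
    exact h m
  · refine Finset.sum_le_sum fun k hk => ?_
    have hkj : k < j := (Finset.mem_Iic.1 hk).trans_lt (not_le.1 hm)
    have := hjmin k hkj
    unfold borelMoveVec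
    grind
termination_by ∑ k, (u k - v k)

end BorelMoves

section PrefixSum

variable {n : ℕ}

lemma card_filter_val_lt {m : ℕ} (hm : m ≤ n) :
    (Finset.univ.filter fun i : Fin n => (i : ℕ) < m).card = m := by
  rw [Fin.card_filter_val_lt, min_eq_right hm]

lemma prefixSum_succ (lam : Fin n → ℕ) (i : Fin n) :
    prefixSum lam (i + 1) = prefixSum lam i + lam i := by
  have h : (Finset.univ.filter fun k : Fin n => (k : ℕ) < i + 1) =
      insert i (Finset.univ.filter fun k : Fin n => (k : ℕ) < i) := by
    ext k
    simp [Fin.ext_iff]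
    omega
  rw [prefixSum, h, Finset.sum_insert (by simp), add_comm]
  rfl

lemma Fin.val_le_of_strictMono {m : ℕ} {e : Fin m → Fin n} (he : StrictMono e) (i : Fin m) :
    (i : ℕ) ≤ e i := by
  obtain ⟨k, hk⟩ := i
  induction k with
  | zero => exact Nat.zero_le _
  | succ k ih =>
    have h : e ⟨k, by omega⟩ < e ⟨k + 1, hk⟩ := he (Nat.lt_succ_self k)
    exact (ih (by omega)).trans_lt h

lemma prefixSum_card_le {lam : Fin n → ℕ} (hlam : Monotone lam) (T : Finset (Fin n)) :
    prefixSum lam T.card ≤ ∑ i ∈ T, lam i := by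
  have hT : T.card ≤ n := by simpa using T.card_le_univ
  have h1 : (Finset.univ.filter fun i : Fin n => (i : ℕ) < T.card) =
      Finset.univ.map (Fin.castLEEmb hT) := by
    ext k
    simp only [Finset.mem_filter, Finset.mem_univ, true_and, Finset.mem_map,
      Fin.castLEEmb_apply]
    exact ⟨fun h => ⟨⟨k, h⟩, rfl⟩, fun ⟨a, ha⟩ => ha ▸ a.2⟩
  have h2 : ∑ i ∈ T, lam i = ∑ i, lam (T.orderEmbOfFin rfl i) := by
    conv_lhs => rw [← T.map_orderEmbOfFin_univ rfl]
    rw [Finset.sum_map]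
    rfl
  rw [prefixSum, h1, h2, Finset.sum_map]
  refine Finset.sum_le_sum fun i _ => hlam ?_
  exact Fin.val_le_of_strictMono (T.orderEmbOfFin rfl).strictMono i

end PrefixSum

lemma Sss_singleton_eq (K : Type) [Field K] (n : ℕ) (lam : Fin n → ℕ) (hlam : Monotone lam) :
    Sss K n {lam} = boundedBelowIdeal K n fun T => prefixSum lam T.card := by
  apply le_antisymm
  · refine sInf_le ⟨isSSSI_boundedBelowIdeal _, ?_⟩
    rintro _ rfl
    rw [mon_mem_boundedBelowIdeal]
    exact fun T => prefixSum_card_le hlam T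
  · refine le_sInf ?_
    rintro J ⟨hJ, hmem⟩
    refine Ideal.span_le.2 ?_
    rintro _ ⟨v, hv, rfl⟩
    have hsort : mon K n (v ∘ Tuple.sort v) ∈ J := by
      refine mon_mem_of_prefix_le hJ (Tuple.monotone_sort v) lam hlam (hmem lam rfl) fun j => ?_
      have h := hv ((Finset.Iic j).map (Tuple.sort v).toEmbedding)
      simp only [Finset.sum_map, Finset.card_map, Fin.card_Iic] at h
      have he : (Finset.univ.filter fun i : Fin n => (i : ℕ) < j + 1) = Finset.Iic j := by
        ext k
        simp only [Finset.mem_filter, Finset.mem_univ, true_and, Finset.mem_Iic]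
        exact Nat.lt_succ_iff
      rw [prefixSum, he] at h
      exact h
    have := mon_comp_mem hJ.2.1 hsort (Tuple.sort v).symm
    rwa [Function.comp_assoc, Equiv.self_comp_symm, Function.comp_id] at this

section Transversal

variable {ι : Type} [Fintype ι] {n : ℕ}

lemma exists_choice_iff (f : ι → Finset (Fin n)) (v : Fin n → ℕ) :
    (∃ c : ι → Fin n, (∀ k, c k ∈ f k) ∧ ∀ i, (Finset.univ.filter fun k => c k = i).card ≤ v i) ↔
      ∀ T : Finset (Fin n), (Finset.univ.filter fun k => f k ⊆ T).card ≤ ∑ i ∈ T, v i := by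
  classical
  constructor
  · rintro ⟨c, hc, hv⟩ T
    have hmaps : ∀ k ∈ Finset.univ.filter fun k => f k ⊆ T, c k ∈ T := fun k hk =>
      (Finset.mem_filter.1 hk).2 (hc k)
    rw [Finset.card_eq_sum_card_fiberwise hmaps]
    refine Finset.sum_le_sum fun i _ => le_trans (Finset.card_le_card ?_) (hv i)
    exact Finset.filter_subset_filter _ (Finset.subset_univ _)
  · intro h
    obtain ⟨e, he, hmem⟩ := (Finset.all_card_le_biUnion_card_iff_exists_injective
      fun k => (f k).sigma fun i => (Finset.univ : Finset (Fin (v i)))).1 (by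
        intro A
        have hU : (A.biUnion fun k => (f k).sigma fun i => (Finset.univ : Finset (Fin (v i)))) =
            (A.biUnion f).sigma fun i => (Finset.univ : Finset (Fin (v i))) := by
          ext x
          simp
        rw [hU, Finset.card_sigma]
        simp only [Finset.card_univ, Fintype.card_fin]
        refine le_trans (Finset.card_le_card fun k hk => ?_) (h _)
        simpa using Finset.subset_biUnion_of_mem f hk)
    refine ⟨fun k => (e k).1, fun k => (Finset.mem_sigma.1 (hmem k)).1, fun i => ?_⟩
    have hcard : (Finset.univ.image (Sigma.mk (β := fun i => Fin (v i)) i)).card ≤ v i := by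
      simpa using Finset.card_image_le (s := Finset.univ)
        (f := Sigma.mk (β := fun i => Fin (v i)) i)
    refine le_trans (Finset.card_le_card_of_injOn e ?_ he.injOn) hcard
    intro k hk
    obtain rfl : (e k).1 = i := by simpa using hk
    simp

lemma prod_span_X_eq (K : Type) [Field K] (f : ι → Finset (Fin n)) :
    ∏ k, Ideal.span ((fun i => (X i : MvPolynomial (Fin n) K)) '' ↑(f k)) =
      boundedBelowIdeal K n fun T => (Finset.univ.filter fun k => f k ⊆ T).card := by
  classical
  have hprod : ∀ c : ι → Fin n, ∏ k, (X (c k) : MvPolynomial (Fin n) K) =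
      mon K n fun i => (Finset.univ.filter fun k => c k = i).card := by
    intro c
    simp only [X, mon]
    rw [← monomial_sum_one]
    refine congrArg (fun s => monomial s (1 : K)) (Finsupp.ext fun i => ?_)
    simp [Finsupp.finsetSum_apply, Finsupp.single_apply]
  rw [Ideal.prod_span]
  apply le_antisymm
  · refine Ideal.span_le.2 fun p hp => ?_
    obtain ⟨q, hq, rfl⟩ := (Set.mem_fintype_prod _ _).1 hp
    choose c hc hcq using hq
    rw [← Finset.prod_congr rfl fun k _ => hcq k, hprod, SetLike.mem_coe,
      mon_mem_boundedBelowIdeal]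
    exact (exists_choice_iff f _).1 ⟨c, hc, fun _ => le_rfl⟩
  · refine Ideal.span_le.2 ?_
    rintro _ ⟨v, hv, rfl⟩
    obtain ⟨c, hc, hcv⟩ := (exists_choice_iff f v).2 hv
    refine mon_mem_of_le (u := fun i => (Finset.univ.filter fun k => c k = i).card) ?_ hcv
    rw [← hprod]
    exact Ideal.subset_span ((Set.mem_fintype_prod _ _).2
      ⟨_, fun k => ⟨c k, hc k, rfl⟩, rfl⟩)

lemma card_subset_eq_prefixSum {K : Type} [Field K] {lam : Fin n → ℕ} (hlam : Monotone lam)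
    (f : ι → Finset (Fin n))
    (h : boundedBelowIdeal K n (fun T => prefixSum lam T.card) =
      boundedBelowIdeal K n fun T => (Finset.univ.filter fun k => f k ⊆ T).card)
    (T : Finset (Fin n)) :
    (Finset.univ.filter fun k => f k ⊆ T).card = prefixSum lam T.card := by
  classical
  have hiff : ∀ v : Fin n → ℕ, (∀ T : Finset (Fin n), prefixSum lam T.card ≤ ∑ i ∈ T, v i) ↔
      ∀ T : Finset (Fin n), (Finset.univ.filter fun k => f k ⊆ T).card ≤ ∑ i ∈ T, v i := by
    intro v
    rw [← mon_mem_boundedBelowIdeal (K := K), h, mon_mem_boundedBelowIdeal]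
  apply le_antisymm
  · have hT : T.card ≤ n := by simpa using T.card_le_univ
    obtain ⟨σ, hσ⟩ := Equiv.Perm.exists_map_finset_eq T
      (Finset.univ.filter fun i : Fin n => (i : ℕ) < T.card) (card_filter_val_lt hT).symm
    have h1 := (hiff (lam ∘ σ)).1 (fun S => by
      have := prefixSum_card_le hlam (S.map σ.toEmbedding)
      simpa using this) T
    rw [prefixSum, ← hσ, Finset.sum_map]
    exact h1
  · have hne : ∀ k, (f k).Nonempty := by
      intro k
      have h0 := (hiff lam).1 (prefixSum_card_le hlam) ∅
      simp only [Finset.sum_empty, nonpos_iff_eq_zero, Finset.card_eq_zero,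
        Finset.filter_eq_empty_iff, Finset.subset_empty] at h0
      exact Finset.nonempty_iff_ne_empty.2 (h0 (Finset.mem_univ k))
    have hc : ∀ k, ∃ i ∈ f k, i ∈ T → f k ⊆ T := by
      intro k
      by_cases hk : f k ⊆ T
      · obtain ⟨i, hi⟩ := hne k
        exact ⟨i, hi, fun _ => hk⟩
      · obtain ⟨i, hi, hiT⟩ := Finset.not_subset.1 hk
        exact ⟨i, hi, fun h => absurd h hiT⟩
    choose c hcf hcT using hc
    have h1 := (hiff _).2 ((exists_choice_iff f _).1 ⟨c, hcf, fun _ => le_rfl⟩) T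
    refine h1.trans (le_of_eq ?_)
    have h2 : (Finset.univ.filter fun k => f k ⊆ T) = Finset.univ.filter fun k => c k ∈ T := by
      ext k
      simp only [Finset.mem_filter, Finset.mem_univ, true_and]
      exact ⟨fun h => h (hcf k), hcT k⟩
    rw [h2, Finset.card_eq_sum_card_fiberwise (f := c) (t := T) fun k hk => by simpa using hk]
    refine Finset.sum_congr rfl fun i hi => ?_
    congr 1
    ext k
    simp only [Finset.mem_filter, Finset.mem_univ, true_and]
    exact ⟨fun h => ⟨h ▸ hi, h⟩, fun h => h.2⟩

lemma card_filter_subset (f : ι → Finset (Fin n)) (T : Finset (Fin n)) :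
    (Finset.univ.filter fun k => f k ⊆ T).card =
      ∑ U ∈ T.powerset, (Finset.univ.filter fun k => f k = U).card := by
  rw [Finset.card_eq_sum_card_fiberwise (f := f) (t := T.powerset) fun k hk => by simpa using hk]
  refine Finset.sum_congr rfl fun U hU => ?_
  congr 1
  ext k
  simp only [Finset.mem_filter, Finset.mem_univ, true_and]
  exact ⟨fun h => h.2, fun h => ⟨h ▸ Finset.mem_powerset.1 hU, h⟩⟩

end Transversal

section BinomialInversion

lemma eq_of_sum_powerset_eq {α : Type*} {b b' : Finset α → ℕ}
    (h : ∀ T : Finset α, ∑ U ∈ T.powerset, b U = ∑ U ∈ T.powerset, b' U) (T : Finset α) :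
    b T = b' T := by
  classical
  induction T using Finset.strongInduction with
  | _ T ih =>
    have hT := h T
    rw [← Finset.insert_erase (Finset.mem_powerset_self T),
      Finset.sum_insert (Finset.notMem_erase _ _),
      Finset.sum_insert (Finset.notMem_erase _ _)] at hT
    have : ∑ U ∈ T.powerset.erase T, b U = ∑ U ∈ T.powerset.erase T, b' U := by
      refine Finset.sum_congr rfl fun U hU => ih U ?_
      rw [Finset.mem_erase, Finset.mem_powerset] at hU
      exact hU.2.ssubset_of_ne hU.1
    omega

lemma exists_eq_card_of_sum_powerset {n : ℕ} {b : Finset (Fin n) → ℕ} {G : ℕ → ℕ}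
    (h : ∀ T : Finset (Fin n), ∑ U ∈ T.powerset, b U = G T.card) :
    ∃ β : ℕ → ℕ, ∀ T, b T = β T.card := by
  refine ⟨fun m => b (Finset.univ.filter fun i : Fin n => (i : ℕ) < m), fun T => ?_⟩
  have hT : T.card ≤ n := by simpa using T.card_le_univ
  obtain ⟨σ, hσ⟩ := Equiv.Perm.exists_map_finset_eq T
    (Finset.univ.filter fun i : Fin n => (i : ℕ) < T.card) (card_filter_val_lt hT).symm
  simp only [← hσ]
  refine eq_of_sum_powerset_eq (b' := fun U => b (U.map σ.toEmbedding)) (fun S => ?_) T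
  have h1 := h (S.map σ.toEmbedding)
  rw [Finset.card_map, ← h S] at h1
  rw [← h1]
  symm
  refine Finset.sum_nbij' (fun U => U.map σ.toEmbedding) (fun U => U.map σ.symm.toEmbedding)
    ?_ ?_ ?_ ?_ ?_
  · intro U hU
    simpa using hU
  · intro U hU
    rw [Finset.mem_powerset] at hU ⊢
    intro x hx
    obtain ⟨y, hy, rfl⟩ := Finset.mem_map.1 hx
    obtain ⟨z, hz, rfl⟩ := Finset.mem_map.1 (hU hy)
    simpa using hz
  · intro U _
    ext x
    simp
  · intro U _
    ext x
    simp
  · intro U _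
    rfl

lemma sum_range_choose_succ (β : ℕ → ℕ) (m : ℕ) :
    ∑ c ∈ Finset.range (m + 1 + 1), (m + 1).choose c * β c =
      ∑ c ∈ Finset.range (m + 1), m.choose c * β c +
        ∑ c ∈ Finset.range (m + 1), m.choose c * β (c + 1) := by
  rw [Finset.sum_range_succ']
  simp only [Nat.choose_succ_succ', add_mul, Finset.sum_add_distrib]
  have h := Finset.sum_range_succ' (fun c => m.choose c * β c) (m + 1)
  rw [Finset.sum_range_succ] at h
  simp only [Nat.choose_succ_self, zero_mul, add_zero, Nat.choose_zero_right, one_mul] at h ⊢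
  omega

lemma Fin.sum_Iic_val {n : ℕ} (F : ℕ → ℕ) (i : Fin n) :
    ∑ j ∈ Finset.Iic i, F j = ∑ j ∈ Finset.range (i + 1), F j := by
  rw [Nat.range_succ_eq_Iic, ← Fin.map_valEmbedding_Iic, Finset.sum_map]
  rfl

end BinomialInversion

/-- For a partition `λ ∈ P_n`, the ideal `Sss({λ})` is a transversal
polymatroidal ideal if and only if there are non-negative integers
`a_1,…,a_n` with `λ_i = Σ_{j=1}^i C(i−1, j−1) a_j` for every `1 ≤ i ≤ n`
(stated here with 0-based indices). -/
theorem principalBorel_transversal_iff (K : Type) [Field K] (n : ℕ)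
    (lam : Fin n → ℕ) (hlam : Monotone lam) :
    IsTransversalPolymatroidal K n (Sss K n {lam}) ↔
      ∃ a : Fin n → ℕ, ∀ i : Fin n,
        lam i = ∑ j ∈ Finset.Iic i, Nat.choose (i : ℕ) (j : ℕ) * a j := by
  rw [Sss_singleton_eq K n lam hlam]
  constructor
  · rintro ⟨s, f, hf⟩
    rw [prod_span_X_eq] at hf
    have hg := card_subset_eq_prefixSum hlam f hf
    simp only [card_filter_subset] at hg
    obtain ⟨β, hβ⟩ := exists_eq_card_of_sum_powerset hg
    have hpre : ∀ m ≤ n,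
        prefixSum lam m = ∑ c ∈ Finset.range (m + 1), m.choose c * β c := by
      intro m hm
      have h := hg (Finset.univ.filter fun i : Fin n => (i : ℕ) < m)
      simp only [hβ] at h
      rw [Finset.sum_powerset_apply_card, card_filter_val_lt hm] at h
      simpa using h.symm
    refine ⟨fun j => β (j + 1), fun i => ?_⟩
    rw [Fin.sum_Iic_val (fun j => (i : ℕ).choose j * β (j + 1)) i]
    have h1 := prefixSum_succ lam i
    rw [hpre _ i.2, hpre _ i.2.le, sum_range_choose_succ] at h1
    omega
  · rintro ⟨a, ha⟩
    let β : ℕ → ℕ := fun c =>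
      match c with
      | 0 => 0
      | c + 1 => if h : c < n then a ⟨c, h⟩ else 0
    have hpre : ∀ m ≤ n,
        prefixSum lam m = ∑ c ∈ Finset.range (m + 1), m.choose c * β c := by
      intro m
      induction m with
      | zero => simp [prefixSum, β]
      | succ m ih =>
        intro hm
        rw [sum_range_choose_succ, ← ih (by omega), prefixSum_succ lam ⟨m, hm⟩, ha,
          ← Fin.sum_Iic_val (fun j => m.choose j * β (j + 1)) ⟨m, hm⟩]
        simp [β]
    let e := Fintype.equivFin (Σ U : Finset (Fin n), Fin (β U.card))
    refine ⟨_, fun k => (e.symm k).1, ?_⟩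
    rw [e.symm.prod_comp fun k =>
      Ideal.span ((fun i => (X i : MvPolynomial (Fin n) K)) '' ↑k.1), prod_span_X_eq]
    congr 1
    ext T
    have hcard : ∀ U : Finset (Fin n), (Finset.univ.filter
        fun k : Σ U : Finset (Fin n), Fin (β U.card) => k.1 = U).card = β U.card := by
      intro U
      have : (Finset.univ.filter fun k : Σ U : Finset (Fin n), Fin (β U.card) => k.1 = U) =
          Finset.univ.map (Function.Embedding.sigmaMk U) := by
        ext ⟨V, x⟩
        simp only [Finset.mem_filter, Finset.mem_univ, true_and, Finset.mem_map,
          Function.Embedding.sigmaMk_apply]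
        constructor
        · rintro rfl
          exact ⟨x, rfl⟩
        · rintro ⟨y, hy⟩
          exact (congrArg Sigma.fst hy).symm
      simp [this]
    rw [card_filter_subset, Finset.sum_congr rfl fun U _ => hcard U,
      Finset.sum_powerset_apply_card, hpre _ (by simpa using T.card_le_univ)]
    simp
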